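/- For every odd integer n > 1, the set NN(n) of near-normal sequences is empty; that is, there is no quadruple of {1,-1}-sequences (A;B;C;D) with A,B of length n+1 and C,D of length n satisfying b_i = (-1)^{i-1} a_i for i = 1,...,n and N_A(j)+N_B(j)+N_C(j)+N_D(j)=0 for all j ≥ 1. -/

import Mathlib

open Finset Matrix Kronecker

/-- Nonperiodic autocorrelation `N_X(j)` of a sequence of length `m` (0-indexed):
`N_X(j) = ∑_{k=0}^{m-j-1} x_k x_{k+j}`. -/
def autocorr (m : ℕ) (X : ℕ → ℤ) (j : ℕ) : ℤ :=
  ∑ k ∈ Finset.range (m - j), X k * X (k + j)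

/-- A binary (±1) sequence of length `m`. -/
def IsBinarySeq (m : ℕ) (X : ℕ → ℤ) : Prop :=
  ∀ i < m, X i = 1 ∨ X i = -1

/-- Base sequences `BS(r,s)`: binary sequences `A, B` of length `r` and `C, D` of
length `s` whose nonperiodic autocorrelations sum to zero for all `j ≥ 1`. -/
def IsBaseSeq (r s : ℕ) (A B C D : ℕ → ℤ) : Prop :=
  IsBinarySeq r A ∧ IsBinarySeq r B ∧ IsBinarySeq s C ∧ IsBinarySeq s D ∧
    ∀ j, 1 ≤ j →
      autocorr r A j + autocorr r B j + autocorr s C j + autocorr s D j = 0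

/-- A Golay pair of length `g`. -/
def IsGolayPair (g : ℕ) (A B : ℕ → ℤ) : Prop :=
  IsBinarySeq g A ∧ IsBinarySeq g B ∧
    ∀ j, 1 ≤ j → autocorr g A j + autocorr g B j = 0

/-- Normal sequences `NS(n)`: base sequences in `BS(n+1,n)` whose first two
sequences agree in the first `n` entries. -/
def IsNormalSeq (n : ℕ) (A B C D : ℕ → ℤ) : Prop :=
  IsBaseSeq (n + 1) n A B C D ∧ ∀ i < n, B i = A i

/-- Near-normal sequences `NN(n)`: base sequences in `BS(n+1,n)` with
`b_i = (-1)^(i-1) a_i` for `i = 1, …, n` (0-indexed: `B i = (-1)^i * A i`). -/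
def IsNearNormalSeq (n : ℕ) (A B C D : ℕ → ℤ) : Prop :=
  IsBaseSeq (n + 1) n A B C D ∧ ∀ i < n, B i = (-1) ^ i * A i

/-- T-sequences of length `t`: four `{-1,0,1}`-sequences such that at every
position exactly one of them is nonzero, and the sum of their nonperiodic
autocorrelations vanishes for all `j ≥ 1`. -/
def IsTSeq (t : ℕ) (T₁ T₂ T₃ T₄ : ℕ → ℤ) : Prop :=
  (∀ i < t, T₁ i ∈ ({-1, 0, 1} : Set ℤ)) ∧
  (∀ i < t, T₂ i ∈ ({-1, 0, 1} : Set ℤ)) ∧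
  (∀ i < t, T₃ i ∈ ({-1, 0, 1} : Set ℤ)) ∧
  (∀ i < t, T₄ i ∈ ({-1, 0, 1} : Set ℤ)) ∧
  (∀ i < t,
    (T₁ i ≠ 0 ∧ T₂ i = 0 ∧ T₃ i = 0 ∧ T₄ i = 0) ∨
    (T₁ i = 0 ∧ T₂ i ≠ 0 ∧ T₃ i = 0 ∧ T₄ i = 0) ∨
    (T₁ i = 0 ∧ T₂ i = 0 ∧ T₃ i ≠ 0 ∧ T₄ i = 0) ∨
    (T₁ i = 0 ∧ T₂ i = 0 ∧ T₃ i = 0 ∧ T₄ i ≠ 0)) ∧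
  ∀ j, 1 ≤ j →
    autocorr t T₁ j + autocorr t T₂ j + autocorr t T₃ j + autocorr t T₄ j = 0

/-- An orthogonal design `OD(4d; d,d,d,d)`: four `4d × 4d` matrices with entries
in `{-1,0,1}`, pairwise disjoint supports covering every position, with
`Aᵢ Aᵢᵀ = d·I` and `Aᵢ Aⱼᵀ + Aⱼ Aᵢᵀ = 0` for `i ≠ j`. -/
def IsOD (d : ℕ) (A : Fin 4 → Matrix (Fin (4 * d)) (Fin (4 * d)) ℤ) : Prop :=
  (∀ k i j, A k i j ∈ ({-1, 0, 1} : Set ℤ)) ∧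
  (∀ i j, ∃! k : Fin 4, A k i j ≠ 0) ∧
  (∀ k, A k * (A k)ᵀ = (d : ℤ) • 1) ∧
  (∀ k l, k ≠ l → A k * (A l)ᵀ + A l * (A k)ᵀ = 0)

/-- Williamson-type matrices of order `w`: four pairwise amicable `±1` matrices
with `∑ Wᵢ Wᵢᵀ = 4w·I`. -/
def IsWilliamsonType (w : ℕ) (W : Fin 4 → Matrix (Fin w) (Fin w) ℤ) : Prop :=
  (∀ k i j, W k i j = 1 ∨ W k i j = -1) ∧
  (∀ k l, W k * (W l)ᵀ = W l * (W k)ᵀ) ∧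
  (∑ k, W k * (W k)ᵀ) = ((4 * w : ℕ) : ℤ) • 1

/-- A Hadamard matrix: a `±1` matrix `H` with `H Hᵀ = m·I`, where `m` is the
size of the (finite) index type. -/
def IsHadamardMatrix {n : Type*} [Fintype n] [DecidableEq n] (H : Matrix n n ℤ) : Prop :=
  (∀ i j, H i j = 1 ∨ H i j = -1) ∧ H * Hᵀ = (Fintype.card n : ℤ) • 1

/-- Modulo 4, consecutive autocorrelations of a binary sequence of length `2k+1` at the
middle shifts `k` and `k+1` differ by 1. -/
lemma four_dvd_autocorr_middle_sub {k : ℕ} {X : ℕ → ℤ} (hX : IsBinarySeq (2 * k + 1) X) :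
    (4 : ℤ) ∣ autocorr (2 * k + 1) X k - autocorr (2 * k + 1) X (k + 1) - 1 := by
  have prod_sub {x y : ℤ} (hx : x = 1 ∨ x = -1) (hy : y = 1 ∨ y = -1) :
      (4 : ℤ) ∣ x * y - (x + y - 1) := by
    rcases hx with rfl | rfl <;> rcases hy with rfl | rfl <;> norm_num
  have hk : (4 : ℤ) ∣ ∑ i ∈ range (k + 1), (X i * X (i + k) - (X i + X (i + k) - 1)) :=
    dvd_sum fun i hi => by
      have := mem_range.1 hi
      exact prod_sub (hX i (by omega)) (hX _ (by omega))
  have hk' : (4 : ℤ) ∣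
      ∑ i ∈ range k, (X i * X (i + (k + 1)) - (X i + X (i + (k + 1)) - 1)) :=
    dvd_sum fun i hi => by
      have := mem_range.1 hi
      exact prod_sub (hX i (by omega)) (hX _ (by omega))
  have hsuffix : ∑ i ∈ range (k + 1), X (i + k) = ∑ i ∈ range k, X (i + (k + 1)) + X k := by
    rw [sum_range_succ']
    simp [add_comm, add_left_comm]
  have hprefix := sum_range_succ X k
  simp only [sum_sub_distrib, sum_add_distrib, hsuffix, hprefix, sum_const, card_range,
    nsmul_eq_mul, mul_one] at hk hk'
  unfold autocorr
  rw [show 2 * k + 1 - k = k + 1 by omega, show 2 * k + 1 - (k + 1) = k by omega]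
  push_cast at hk hk'
  rcases hX k (by omega) with h | h <;> rw [h] at hk <;> omega

/-- The autocorrelation of a binary sequence has the parity of its number of terms. -/
lemma two_dvd_autocorr_sub {m : ℕ} {X : ℕ → ℤ} (hX : IsBinarySeq m X) (j : ℕ) :
    (2 : ℤ) ∣ autocorr m X j - (m - j : ℕ) := by
  have h : (2 : ℤ) ∣ ∑ i ∈ range (m - j), (X i * X (i + j) - 1) :=
    dvd_sum fun i hi => by
      have := mem_range.1 hi
      rcases hX i (by omega) with h | h <;> rcases hX (i + j) (by omega) with h' | h' <;>
        simp [h, h']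
  simpa [autocorr] using h

/-- Alternating the signs of a sequence multiplies its autocorrelation at `j` by `(-1)^j`. -/
lemma autocorr_alternating {m : ℕ} {X Y : ℕ → ℤ} (h : ∀ i < m, Y i = (-1) ^ i * X i) (j : ℕ) :
    autocorr m Y j = (-1) ^ j * autocorr m X j := by
  unfold autocorr
  rw [mul_sum]
  refine sum_congr rfl fun i hi => ?_
  have := mem_range.1 hi
  rw [h i (by omega), h (i + j) (by omega), pow_add]
  have hsq : ((-1 : ℤ) ^ i) * (-1) ^ i = 1 := by rw [← mul_pow]; simp
  linear_combination (-1) ^ j * X i * X (i + j) * hsq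

/-- For a binary sequence of even length and its alternation, the autocorrelations sum to
a multiple of 4. -/
lemma four_dvd_autocorr_add_alternating {m : ℕ} (hm : Even m) {X Y : ℕ → ℤ}
    (hX : IsBinarySeq m X) (h : ∀ i < m, Y i = (-1) ^ i * X i) {j : ℕ} (hj : j ≤ m) :
    (4 : ℤ) ∣ autocorr m X j + autocorr m Y j := by
  rw [autocorr_alternating h]
  rcases Nat.even_or_odd j with he | ho
  · have := two_dvd_autocorr_sub hX j
    obtain ⟨a, rfl⟩ := hm
    rw [he.neg_one_pow]
    obtain ⟨b, rfl⟩ := he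
    omega
  · simp [ho.neg_one_pow]

/-- In near-normal sequences of odd order, `B` is the alternation of `A` also at the last
entry. -/
lemma IsNearNormalSeq.alternating {n : ℕ} (hn : Odd n) {A B C D : ℕ → ℤ}
    (h : IsNearNormalSeq n A B C D) : ∀ i < n + 1, B i = (-1) ^ i * A i := by
  obtain ⟨⟨hA, hB, -, -, hsum⟩, halt⟩ := h
  have hlast := hsum n hn.pos
  have h0 := halt 0 hn.pos
  simp only [autocorr, Nat.add_sub_cancel_left, Nat.sub_self, sum_range_one, sum_range_zero,
    zero_add, h0, pow_zero, one_mul, add_zero] at hlast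
  intro i hi
  rcases Nat.lt_succ_iff_lt_or_eq.1 hi with hi | rfl
  · exact halt i hi
  · rw [hn.neg_one_pow]
    rcases hA 0 (by omega) with h | h <;> rw [h] at hlast <;> linarith

/-- For every odd integer `n > 1`, the set `NN(n)` of
near-normal sequences is empty. -/
theorem near_normal_empty_for_odd (n : ℕ) (hn : Odd n) (h1 : 1 < n) :
    ¬ ∃ A B C D : ℕ → ℤ, IsNearNormalSeq n A B C D := by
  rintro ⟨A, B, C, D, h⟩
  have halt := h.alternating hn
  obtain ⟨⟨hA, -, hC, hD, hsum⟩, -⟩ := h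
  have heven : Even (n + 1) := hn.add_one
  obtain ⟨k, rfl⟩ := hn
  have hk := four_dvd_autocorr_add_alternating heven hA halt (j := k) (by omega)
  have hk' := four_dvd_autocorr_add_alternating heven hA halt (j := k + 1) (by omega)
  have hsk := hsum k (by omega)
  have hsk' := hsum (k + 1) (by omega)
  have hCk := four_dvd_autocorr_middle_sub hC
  have hDk := four_dvd_autocorr_middle_sub hD
  omega
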